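/- Fix c ∈ {6, 7} and set τ = 2^{−20}. There exists a constant C > 0 such that for every sufficiently large integer n, ∫_{𝓔_c} |F_c(α)| dα ≤ C · n^{Θ_c − τ}, where 𝓔_6 = {α ∈ [0,1] : |f_6(α)| ≤ P_6^{1 − 24τ}} and 𝓔_7 = {α ∈ [0,1] : |f_7(α)| ≤ P_7^{139/140 − 24τ}}. -/

import Mathlib

open MeasureTheory Finset

noncomputable section

/-- `e(x) = exp(2πix)`. -/
def e (x : ℝ) : ℂ := Complex.exp (2 * Real.pi * Complex.I * x)

/-- `P_k = n^(1/k)`. -/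
def P (n k : ℕ) : ℝ := (n : ℝ) ^ ((k : ℝ))⁻¹

/-- `θ_6 = 5/6`, `θ_7 = 87/98`. -/
def θ (c : ℕ) : ℝ := if c = 6 then 5 / 6 else 87 / 98

/-- `Θ_c = 2/3 + θ_c/5 + 1/6 + 1/c`. -/
def Θ (c : ℕ) : ℝ := 2 / 3 + θ c / 5 + 1 / 6 + ((c : ℝ))⁻¹

/-- `f_k(α) = Σ_{P_k/2 < p ≤ P_k, p prime} e(α p^k) log p`. -/
def f (n k : ℕ) (α : ℝ) : ℂ :=
  ∑ p ∈ (Finset.range (n + 1)).filter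
      (fun p : ℕ => p.Prime ∧ P n k / 2 < (p : ℝ) ∧ (p : ℝ) ≤ P n k),
    e (α * (p : ℝ) ^ k) * (Real.log p)

/-- `f_{5,c}(α) = Σ_{1 < p ≤ P_5^{θ_c}, p prime} e(α p^5) log p`. -/
def f5 (n c : ℕ) (α : ℝ) : ℂ :=
  ∑ p ∈ (Finset.range (n + 1)).filter
      (fun p : ℕ => p.Prime ∧ 1 < (p : ℝ) ∧ (p : ℝ) ≤ P n 5 ^ θ c),
    e (α * (p : ℝ) ^ 5) * (Real.log p)

/-- `F_c(α) = f_2(α)^2 f_3(α)^2 f_{5,c}(α) f_6(α) f_c(α)`. -/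
def F (n c : ℕ) (α : ℝ) : ℂ :=
  f n 2 α ^ 2 * f n 3 α ^ 2 * f5 n c α * f n 6 α * f n c α

/-- `S_k(q,a) = Σ_{x=1,(x,q)=1}^{q} e(a x^k / q)`. -/
def S (k q a : ℕ) : ℂ :=
  ∑ x ∈ (Finset.Icc 1 q).filter (fun x => Nat.gcd x q = 1),
    e ((a : ℝ) * (x : ℝ) ^ k / q)

/-- `v_k(β) = (1/k) Σ_{2^{-k} n < m ≤ n} m^{1/k-1} e(β m)`. -/
def v (n k : ℕ) (β : ℝ) : ℂ :=
  ((k : ℂ))⁻¹ *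
    ∑ m ∈ (Finset.Icc 1 n).filter (fun m : ℕ => (n : ℝ) / 2 ^ k < (m : ℝ)),
      ((m : ℝ) ^ ((k : ℝ)⁻¹ - 1) : ℝ) * e (β * m)

/-- `w_c(β) = v_2(β)^2 v_3(β)^2 v_6(β) v_c(β)`. -/
def w (n c : ℕ) (β : ℝ) : ℂ := v n 2 β ^ 2 * v n 3 β ^ 2 * v n 6 β * v n c β

/-- `U_c(q,a) = S_2(q,a)^2 S_3(q,a)^2 S_5(q,a) S_6(q,a) S_c(q,a)`. -/
def U (c q a : ℕ) : ℂ := S 2 q a ^ 2 * S 3 q a ^ 2 * S 5 q a * S 6 q a * S c q a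

/-- `A_{n,c}(q) = Σ_{a=1,(a,q)=1}^{q} U_c(q,a) e(-a n / q)`. -/
def A (n : ℤ) (c q : ℕ) : ℂ :=
  ∑ a ∈ (Finset.Icc 1 q).filter (fun a => Nat.gcd a q = 1),
    U c q a * e (-((a : ℝ) * (n : ℝ)) / q)

/-- The major arcs `𝔐`. -/
def Maj (n : ℕ) (B : ℝ) : Set ℝ :=
  {α | α ∈ Set.Icc (0 : ℝ) 1 ∧ ∃ a q : ℕ, a ≤ q ∧ 1 ≤ q ∧
    (q : ℝ) ≤ Real.log n ^ B ∧ Nat.gcd a q = 1 ∧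
    |α - (a : ℝ) / q| ≤ Real.log n ^ B / n}

/-- `Q_c = n^{2/(3c²(c-1))}`. -/
def Q (n c : ℕ) : ℝ := (n : ℝ) ^ (2 / (3 * (c : ℝ) ^ 2 * ((c : ℝ) - 1)))

/-- The arcs `𝕽_c`. -/
def R (n c : ℕ) : Set ℝ :=
  {α | α ∈ Set.Icc (0 : ℝ) 1 ∧ ∃ a q : ℕ, a ≤ q ∧ 1 ≤ q ∧
    (q : ℝ) ≤ Q n c ∧ Nat.gcd a q = 1 ∧ |(q : ℝ) * α - a| ≤ Q n c / n}

/-- `τ = 2^{-20}`. -/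
def τ : ℝ := ((2 : ℝ) ^ (20 : ℕ))⁻¹

/-- The sets `𝓔_c`. -/
def E (n c : ℕ) : Set ℝ :=
  {α | α ∈ Set.Icc (0 : ℝ) 1 ∧
    ‖f n c α‖ ≤ P n c ^ (if c = 6 then 1 - 24 * τ else 139 / 140 - 24 * τ)}

end


lemma div_bound (ε : ℝ) (hε : 0 < ε) : ∃ C : ℝ, 0 < C ∧ ∀ m : ℕ, m ≠ 0 →
    ((m.divisors.card : ℕ) : ℝ) ≤ C * (m : ℝ) ^ ε := by
  set C0 : ℝ := max 1 (1 / (ε * Real.log 2)) with hC0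
  have hl2 : 0 < Real.log 2 := Real.log_pos (by norm_num)
  have h1C : 1 ≤ C0 := le_max_left _ _
  have hC0' : 1 ≤ C0 * (ε * Real.log 2) := by
    have : 1 / (ε * Real.log 2) ≤ C0 := le_max_right _ _
    rwa [div_le_iff₀ (by positivity)] at this
  obtain ⟨K, hK⟩ := exists_nat_ge ((2 : ℝ) ^ (1 / ε))
  refine ⟨C0 ^ K, by positivity, fun m hm => ?_⟩
  have key : ∀ p ∈ m.primeFactors, ((m.factorization p + 1 : ℕ) : ℝ) ≤
      (if p < K then C0 else 1) * (((p ^ m.factorization p : ℕ) : ℝ) ^ ε) := by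
    intro p hp
    have hp2 : 2 ≤ p := (Nat.prime_of_mem_primeFactors hp).two_le
    generalize m.factorization p = a
    have hp0 : (0 : ℝ) ≤ p := by positivity
    have e1 : (((p ^ a : ℕ) : ℝ) ^ ε) = ((p : ℝ) ^ ε) ^ a := by
      push_cast
      rw [← Real.rpow_natCast, ← Real.rpow_natCast, ← Real.rpow_mul hp0, ← Real.rpow_mul hp0,
        mul_comm]
    rw [e1]
    split_ifs with h
    · have h2 : (2 : ℝ) ^ ε ≤ (p : ℝ) ^ ε :=
        Real.rpow_le_rpow (by norm_num) (by exact_mod_cast hp2) hε.le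
      have h3 : 1 + ε * Real.log 2 ≤ (2 : ℝ) ^ ε := by
        rw [Real.rpow_def_of_pos (by norm_num)]
        have := Real.add_one_le_exp (Real.log 2 * ε)
        linarith
      have h4 : 1 + (a : ℝ) * (ε * Real.log 2) ≤ (1 + ε * Real.log 2) ^ a :=
        one_add_mul_le_pow (by nlinarith) a
      have h5 : (1 + ε * Real.log 2) ^ a ≤ ((p : ℝ) ^ ε) ^ a :=
        pow_le_pow_left₀ (by positivity) (h3.trans h2) a
      have h6 : 1 + (a : ℝ) * (ε * Real.log 2) ≤ ((p : ℝ) ^ ε) ^ a := h4.trans h5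
      have h7 := mul_le_mul_of_nonneg_left h6 (by positivity : 0 ≤ C0)
      have h8 : (a : ℝ) * 1 ≤ a * (C0 * (ε * Real.log 2)) :=
        mul_le_mul_of_nonneg_left hC0' (by positivity)
      push_cast
      nlinarith
    · have h2 : (2 : ℝ) ≤ (p : ℝ) ^ ε := by
        have : (2 : ℝ) ^ (1 / ε) ≤ p := hK.trans (by exact_mod_cast not_lt.mp h)
        have := Real.rpow_le_rpow (by positivity) this hε.le
        rwa [← Real.rpow_mul (by norm_num), one_div_mul_cancel hε.ne', Real.rpow_one] at this
      have h3 : (2 : ℝ) ^ a ≤ ((p : ℝ) ^ ε) ^ a := pow_le_pow_left₀ (by norm_num) h2 a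
      have h4 : a + 1 ≤ 2 ^ a := Nat.lt_two_pow_self
      have h5 : ((a + 1 : ℕ) : ℝ) ≤ 2 ^ a := by exact_mod_cast h4
      linarith
  have hm' : (m : ℝ) ^ ε = ∏ p ∈ m.primeFactors, (((p ^ m.factorization p : ℕ) : ℝ) ^ ε) := by
    rw [Real.finsetProd_rpow _ _ (fun i _ => by positivity)]
    congr 1
    have := Nat.prod_factorization_pow_eq_self hm
    rw [Finsupp.prod, Nat.support_factorization] at this
    exact_mod_cast this.symm
  rw [Nat.card_divisors hm, hm']
  push_cast
  calc ∏ p ∈ m.primeFactors, ((m.factorization p : ℝ) + 1)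
      ≤ ∏ p ∈ m.primeFactors, ((if p < K then C0 else 1) * (((p ^ m.factorization p : ℕ) : ℝ) ^ ε)) := by
        apply Finset.prod_le_prod
        · intros; positivity
        · intro p hp; exact_mod_cast key p hp
    _ = (∏ p ∈ m.primeFactors, (if p < K then C0 else 1)) *
        ∏ p ∈ m.primeFactors, (((p ^ m.factorization p : ℕ) : ℝ) ^ ε) := Finset.prod_mul_distrib
    _ ≤ _ := by
        push_cast
        apply mul_le_mul_of_nonneg_right _ (Finset.prod_nonneg fun _ _ => by positivity)
        rw [← Finset.prod_filter, Finset.prod_const]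
        apply pow_le_pow_right₀ h1C
        calc _ ≤ (Finset.range K).card := Finset.card_le_card (by
              intro p hp; simp at hp ⊢; exact hp.2)
          _ = K := Finset.card_range K

lemma int_e (m : ℤ) : ∫ α in (0:ℝ)..1, e (α * m) = if m = 0 then 1 else 0 := by
  split_ifs with h
  · simp [h, e]
  · have hc : (2 * Real.pi * Complex.I * m : ℂ) ≠ 0 := by
      simp [Real.pi_ne_zero, h]
    have := integral_exp_mul_complex (a := 0) (b := 1) hc
    have e1 : ∀ α : ℝ, e (α * m) = Complex.exp (2 * Real.pi * Complex.I * m * α) := by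
      intro α; unfold e; congr 1; push_cast; ring
    simp_rw [e1]
    rw [this]
    have : Complex.exp (2 * Real.pi * Complex.I * m * (1:ℝ)) = 1 := by
      rw [← Complex.exp_int_mul_two_pi_mul_I m]; congr 1; push_cast; ring
    rw [this]; simp

lemma continuous_e : Continuous e := by unfold e; fun_prop

lemma conj_e (x : ℝ) : (starRingEnd ℂ) (e x) = e (-x) := by
  unfold e
  rw [← Complex.exp_conj]; congr 1
  have : (starRingEnd ℂ) 2 = 2 := map_ofNat _ 2
  simp [this]

lemma e_add (x y : ℝ) : e (x + y) = e x * e y := by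
  unfold e
  rw [← Complex.exp_add]; congr 1; push_cast; ring

lemma parseval {ι : Type*} (T : Finset ι) (φ : ι → ℕ) (w : ι → ℝ) :
    ∫ α in (0:ℝ)..1, ‖∑ t ∈ T, e (α * φ t) * (w t : ℂ)‖ ^ 2 =
      ∑ t ∈ T, ∑ s ∈ T, if φ t = φ s then w t * w s else 0 := by
  apply Complex.ofReal_injective
  rw [← intervalIntegral.integral_ofReal]
  have h : ∀ α : ℝ, ((‖∑ t ∈ T, e (α * φ t) * (w t : ℂ)‖ ^ 2 : ℝ) : ℂ) =
      ∑ t ∈ T, ∑ s ∈ T, e (α * ((φ t : ℤ) - (φ s : ℤ) : ℤ)) * ((w t : ℂ) * w s) := by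
    intro α
    rw [Complex.ofReal_pow, ← Complex.mul_conj', map_sum, Finset.sum_mul_sum]
    refine Finset.sum_congr rfl fun t _ => Finset.sum_congr rfl fun s _ => ?_
    have : α * (((φ t : ℤ) - (φ s : ℤ) : ℤ) : ℝ) = α * φ t + -(α * φ s) := by push_cast; ring
    rw [this, e_add, map_mul, conj_e, Complex.conj_ofReal]; ring
  have hi : ∀ t s, IntervalIntegrable (fun α : ℝ => e (α * ((φ t : ℤ) - (φ s : ℤ) : ℤ)) * ((w t : ℂ) * w s)) volume 0 1 := by
    intro t s
    apply Continuous.intervalIntegrable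
    have := continuous_e
    fun_prop
  simp_rw [h]
  rw [intervalIntegral.integral_finsetSum]
  · push_cast
    refine Finset.sum_congr rfl fun t _ => ?_
    rw [intervalIntegral.integral_finsetSum (fun s _ => by simpa using hi t s)]
    refine Finset.sum_congr rfl fun s _ => ?_
    rw [intervalIntegral.integral_mul_const]
    have := int_e ((φ t : ℤ) - (φ s : ℤ))
    push_cast at this
    rw [this]
    by_cases hh : φ t = φ s
    · simp [hh]
    · have : (φ t : ℤ) - φ s ≠ 0 := by omega
      simp [hh, this]
  · intro t _
    apply Continuous.intervalIntegrable
    have := continuous_e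
    fun_prop

/-- Number of pairs in `A` with `g a - g a' = M`. -/
def rep (A : Finset ℕ) (g : ℕ → ℕ) (M : ℤ) : ℕ :=
  ((A ×ˢ A).filter (fun x => (g x.1 : ℤ) - g x.2 = M)).card

lemma rep_zero (A : Finset ℕ) (g : ℕ → ℕ) (hg : Function.Injective g) : rep A g 0 ≤ A.card := by
  unfold rep
  apply Finset.card_le_card_of_injOn Prod.fst
  · intro x hx; simp at hx ⊢; exact hx.1.1
  · intro x hx y hy hxy
    simp at hx hy
    have h1 : x.1 = x.2 := hg (by have := hx.2; omega)
    have h2 : y.1 = y.2 := hg (by have := hy.2; omega)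
    exact Prod.ext hxy (by rw [← h1, ← h2, hxy])

lemma rep_sq (A : Finset ℕ) (n D : ℕ) (hA : ∀ a ∈ A, 0 < a ∧ a ^ 2 ≤ n)
    (hD : ∀ m : ℕ, m ≠ 0 → m ≤ n → m.divisors.card ≤ D) (M : ℤ) (hM : M ≠ 0) :
    rep A (fun a => a ^ 2) M ≤ D := by
  by_cases hn : M.natAbs ≤ n
  · refine le_trans ?_ (hD M.natAbs (by omega) hn)
    unfold rep
    apply Finset.card_le_card_of_injOn (fun x => x.1 + x.2)
    · rintro ⟨a, b⟩ hx
      simp at hx ⊢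
      refine ⟨?_, hM⟩
      rw [← Int.natCast_dvd]
      exact ⟨(a : ℤ) - b, by rw [← hx.2]; push_cast; ring⟩
    · rintro ⟨a, b⟩ hx ⟨c, d⟩ hy hxy
      simp at hx hy hxy
      have hs : (a : ℤ) + b = c + d := by exact_mod_cast hxy
      have ha := (hA a hx.1.1).1
      have h1 : ((a : ℤ) + b) * (((a : ℤ) - b) - (c - d)) = 0 := by
        have : ((c : ℤ) + d) * (c - d) = M := by rw [← hy.2]; ring
        have h' : ((a : ℤ) + b) * (a - b) = M := by rw [← hx.2]; ring
        rw [mul_sub, h', hs, this]; ring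
      rcases mul_eq_zero.mp h1 with h | h
      · omega
      · ext <;> simp <;> omega
  · unfold rep
    rw [Finset.card_eq_zero.mpr]
    · omega
    · rw [Finset.filter_eq_empty_iff]
      rintro ⟨a, b⟩ hx
      simp at hx ⊢
      have h1 := (hA a hx.1).2
      have h2 := (hA b hx.2).2
      have h1' : ((a : ℤ)) ^ 2 ≤ n := by exact_mod_cast h1
      have h2' : ((b : ℤ)) ^ 2 ≤ n := by exact_mod_cast h2
      have := sq_nonneg (a : ℤ)
      have := sq_nonneg (b : ℤ)
      omega

lemma rep_cube (A : Finset ℕ) (n D : ℕ) (hA : ∀ a ∈ A, 0 < a ∧ a ^ 3 ≤ n)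
    (hD : ∀ m : ℕ, m ≠ 0 → m ≤ n → m.divisors.card ≤ D) (M : ℤ) (hM : M ≠ 0) :
    rep A (fun a => a ^ 3) M ≤ D := by
  by_cases hn : M.natAbs ≤ n
  · refine le_trans ?_ (hD M.natAbs (by omega) hn)
    unfold rep
    apply Finset.card_le_card_of_injOn (fun x => ((x.1 : ℤ) - x.2).natAbs)
    · rintro ⟨a, b⟩ hx
      simp at hx ⊢
      refine ⟨?_, hM⟩
      try rw [Int.natAbs_dvd_natAbs]
      exact ⟨(a : ℤ) ^ 2 + a * b + b ^ 2, by rw [← hx.2]; push_cast; ring⟩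
    · rintro ⟨a, b⟩ hx ⟨c, d⟩ hy hxy
      simp at hx hy hxy
      have ha : (0 : ℤ) < a := by exact_mod_cast (hA a hx.1.1).1
      have hb : (0 : ℤ) < b := by exact_mod_cast (hA b hx.1.2).1
      have hc : (0 : ℤ) < c := by exact_mod_cast (hA c hy.1.1).1
      have hd : (0 : ℤ) < d := by exact_mod_cast (hA d hy.1.2).1
      have hab : ((a : ℤ) - b) * ((a : ℤ) ^ 2 + a * b + b ^ 2) = M := by rw [← hx.2]; ring
      have hcd : ((c : ℤ) - d) * ((c : ℤ) ^ 2 + c * d + d ^ 2) = M := by rw [← hy.2]; ring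
      have hne : (a : ℤ) - b ≠ 0 := by rintro h; rw [h] at hab; simp at hab; exact hM hab.symm
      have hs : (a : ℤ) - b = c - d := by
        rcases Int.natAbs_eq_natAbs_iff.mp hxy with h | h
        · exact h
        · exfalso
          have h1 : ((a : ℤ) - b) * (((a : ℤ) ^ 2 + a * b + b ^ 2) + ((c : ℤ) ^ 2 + c * d + d ^ 2)) = 0 := by
            have : (c : ℤ) - d = -(a - b) := by omega
            rw [this] at hcd
            linarith
          rcases mul_eq_zero.mp h1 with h | h
          · exact hne h
          · have : 0 < ((a : ℤ) ^ 2 + a * b + b ^ 2) + ((c : ℤ) ^ 2 + c * d + d ^ 2) := by positivity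
            omega
      have h1 : ((a : ℤ) - b) * (3 * (((b : ℤ) - d) * (b + c))) = 0 := by
        have hq : ((a : ℤ) - b) * (((a : ℤ) ^ 2 + a * b + b ^ 2) - ((c : ℤ) ^ 2 + c * d + d ^ 2)) = 0 := by
          rw [← hs] at hcd
          linarith
        have ha' : (a : ℤ) = b + (c - d) := by omega
        rw [← hq, ha']; ring
      have h2 : (b : ℤ) - d = 0 := by
        rcases mul_eq_zero.mp h1 with h | h
        · exact absurd h hne
        · rcases mul_eq_zero.mp h with h | h
          · omega
          · rcases mul_eq_zero.mp h with h | h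
            · exact h
            · omega
      ext <;> simp <;> omega
  · unfold rep
    rw [Finset.card_eq_zero.mpr]
    · omega
    · rw [Finset.filter_eq_empty_iff]
      rintro ⟨a, b⟩ hx
      simp at hx ⊢
      have h1 := (hA a hx.1).2
      have h2 := (hA b hx.2).2
      have h1' : ((a : ℤ)) ^ 3 ≤ n := by exact_mod_cast h1
      have h2' : ((b : ℤ)) ^ 3 ≤ n := by exact_mod_cast h2
      have : 0 ≤ (a : ℤ) ^ 3 := by positivity
      have : 0 ≤ (b : ℤ) ^ 3 := by positivity
      omega

/-- Number of pairs in `Y` with equal values of `ψ`. -/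
def cnt {β : Type*} (Y : Finset β) (ψ : β → ℕ) : ℕ :=
  ∑ y ∈ Y, ∑ y' ∈ Y, if ψ y = ψ y' then 1 else 0

lemma cnt_prod {β : Type*} (A : Finset ℕ) (g : ℕ → ℕ) (hg : Function.Injective g) (D : ℕ)
    (hrep : ∀ M : ℤ, M ≠ 0 → rep A g M ≤ D) (Y : Finset β) (ψ : β → ℕ) :
    cnt (A ×ˢ Y) (fun x => g x.1 + ψ x.2) ≤ D * Y.card ^ 2 + A.card * cnt Y ψ := by
  have h1 : cnt (A ×ˢ Y) (fun x => g x.1 + ψ x.2) =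
      ∑ y ∈ Y, ∑ y' ∈ Y, rep A g ((ψ y' : ℤ) - ψ y) := by
    unfold cnt rep
    simp_rw [Finset.sum_product, Finset.card_filter, Finset.sum_product]
    rw [Finset.sum_comm]
    refine Finset.sum_congr rfl fun y _ => ?_
    trans ∑ a ∈ A, ∑ y' ∈ Y, ∑ a' ∈ A, (if g a + ψ y = g a' + ψ y' then 1 else 0)
    · exact Finset.sum_congr rfl fun a _ => Finset.sum_comm
    rw [Finset.sum_comm]
    refine Finset.sum_congr rfl fun y' _ => ?_
    refine Finset.sum_congr rfl fun a _ => Finset.sum_congr rfl fun a' _ => ?_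
    congr 1
    apply propext
    constructor <;> intro h <;> omega
  have h2 : ∀ y y', rep A g ((ψ y' : ℤ) - ψ y) ≤ D + A.card * (if ψ y = ψ y' then 1 else 0) := by
    intro y y'
    split_ifs with h
    · rw [h, sub_self]
      have := rep_zero A g hg
      omega
    · have := hrep ((ψ y' : ℤ) - ψ y) (by omega)
      omega
  rw [h1]
  calc _ ≤ ∑ y ∈ Y, ∑ y' ∈ Y, (D + A.card * (if ψ y = ψ y' then 1 else 0)) :=
        Finset.sum_le_sum fun y _ => Finset.sum_le_sum fun y' _ => h2 y y'
    _ = _ := by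
        unfold cnt
        simp_rw [Finset.sum_add_distrib, ← Finset.mul_sum]
        simp; ring

lemma cnt_inj {β : Type*} (Y : Finset β) (ψ : β → ℕ) (h : Function.Injective ψ) :
    cnt Y ψ ≤ Y.card := by
  classical
  unfold cnt
  simp_rw [h.eq_iff]
  simp

/-- Weighted exponential sum. -/
noncomputable def W (A : Finset ℕ) (k : ℕ) (α : ℝ) : ℂ :=
  ∑ p ∈ A, e (α * (p : ℝ) ^ k) * (Real.log p)

lemma continuous_W (A : Finset ℕ) (k : ℕ) : Continuous (W A k) := by
  unfold W
  have := continuous_e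
  fun_prop

lemma W_mul (A B Z : Finset ℕ) (k : ℕ) (α : ℝ) : W A 2 α * W B 3 α * W Z k α =
    ∑ t ∈ A ×ˢ (B ×ˢ Z), e (α * ((t.1 ^ 2 + (t.2.1 ^ 3 + t.2.2 ^ k) : ℕ) : ℝ)) *
      ((Real.log t.1 * Real.log t.2.1 * Real.log t.2.2 : ℝ) : ℂ) := by
  unfold W
  rw [Finset.sum_product, mul_assoc, Finset.sum_mul]
  refine Finset.sum_congr rfl fun a _ => ?_
  rw [Finset.sum_product, Finset.sum_mul_sum, Finset.mul_sum]
  refine Finset.sum_congr rfl fun b _ => ?_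
  rw [Finset.mul_sum]
  refine Finset.sum_congr rfl fun z _ => ?_
  push_cast
  rw [mul_add, mul_add, e_add, e_add]
  ring

lemma mean_value (A B Z : Finset ℕ) (k n D : ℕ) (hk : k ≠ 0) (L : ℝ)
    (hA : ∀ a ∈ A, 0 < a ∧ a ^ 2 ≤ n) (hB : ∀ a ∈ B, 0 < a ∧ a ^ 3 ≤ n)
    (hD : ∀ m : ℕ, m ≠ 0 → m ≤ n → m.divisors.card ≤ D)
    (hAL : ∀ a ∈ A, Real.log a ≤ L) (hBL : ∀ a ∈ B, Real.log a ≤ L)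
    (hZL : ∀ a ∈ Z, Real.log a ≤ L) :
    ∫ α in (0:ℝ)..1, ‖W A 2 α * W B 3 α * W Z k α‖ ^ 2 ≤
      L ^ 6 * (D * ((B.card : ℝ) * Z.card) ^ 2 + A.card * (D * (Z.card : ℝ) ^ 2 + B.card * Z.card)) := by
  have hinj : ∀ j : ℕ, j ≠ 0 → Function.Injective (fun a : ℕ => a ^ j) := fun j hj =>
    Nat.pow_left_injective hj
  have h1 := cnt_prod A (fun a => a ^ 2) (hinj 2 (by norm_num)) D (rep_sq A n D hA hD) (B ×ˢ Z)
    (fun x => x.1 ^ 3 + x.2 ^ k)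
  have h2 := cnt_prod B (fun a => a ^ 3) (hinj 3 (by norm_num)) D (rep_cube B n D hB hD) Z
    (fun x => x ^ k)
  have h3 := cnt_inj Z (fun x => x ^ k) (hinj k hk)
  have h4 : cnt (A ×ˢ (B ×ˢ Z)) (fun t => t.1 ^ 2 + (t.2.1 ^ 3 + t.2.2 ^ k)) ≤
      D * (B.card * Z.card) ^ 2 + A.card * (D * Z.card ^ 2 + B.card * Z.card) := by
    refine h1.trans ?_
    rw [Finset.card_product]
    gcongr
    refine h2.trans ?_
    gcongr
  have h5 : ((cnt (A ×ˢ (B ×ˢ Z)) (fun t => t.1 ^ 2 + (t.2.1 ^ 3 + t.2.2 ^ k)) : ℕ) : ℝ) ≤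
      (D * ((B.card : ℝ) * Z.card) ^ 2 + A.card * (D * (Z.card : ℝ) ^ 2 + B.card * Z.card)) := by
    exact_mod_cast h4
  simp_rw [W_mul]
  rw [parseval]
  have hw : ∀ t ∈ A ×ˢ (B ×ˢ Z), 0 ≤ Real.log t.1 * Real.log t.2.1 * Real.log t.2.2 ∧
      Real.log t.1 * Real.log t.2.1 * Real.log t.2.2 ≤ L ^ 3 := by
    rintro ⟨a, b, z⟩ ht
    simp only [Finset.mem_product] at ht
    have l1 := Real.log_natCast_nonneg a
    have l2 := Real.log_natCast_nonneg b
    have l3 := Real.log_natCast_nonneg z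
    refine ⟨by positivity, ?_⟩
    have hL : 0 ≤ L := l1.trans (hAL a ht.1)
    calc _ ≤ L * L * L := by
          gcongr
          · exact hAL a ht.1
          · exact hBL b ht.2.1
          · exact hZL z ht.2.2
      _ = L ^ 3 := by ring
  refine le_trans ?_ (mul_le_mul_of_nonneg_left h5 (by positivity))
  unfold cnt
  push_cast
  rw [Finset.mul_sum]
  refine Finset.sum_le_sum fun t ht => ?_
  rw [Finset.mul_sum]
  refine Finset.sum_le_sum fun s hs => ?_
  split_ifs with h
  · have := mul_le_mul (hw t ht).2 (hw s hs).2 (hw s hs).1 ((hw t ht).1.trans (hw t ht).2)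
    calc _ ≤ _ := this
      _ = _ := by ring
  · simp

/-- The index set of `f n k`. -/
noncomputable def idx (n k : ℕ) : Finset ℕ :=
  (Finset.range (n + 1)).filter
      (fun p : ℕ => p.Prime ∧ P n k / 2 < (p : ℝ) ∧ (p : ℝ) ≤ P n k)

/-- The index set of `f5 n c`. -/
noncomputable def idx5 (n c : ℕ) : Finset ℕ :=
  (Finset.range (n + 1)).filter
      (fun p : ℕ => p.Prime ∧ 1 < (p : ℝ) ∧ (p : ℝ) ≤ P n 5 ^ θ c)

lemma f_eq (n k : ℕ) : f n k = W (idx n k) k := rfl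
lemma f5_eq (n c : ℕ) : f5 n c = W (idx5 n c) 5 := rfl

lemma card_le_of (Z : Finset ℕ) (x : ℝ) (h : ∀ z ∈ Z, 0 < z ∧ (z : ℝ) ≤ x) (hx : 0 ≤ x) :
    (Z.card : ℝ) ≤ x := by
  have : Z.card ≤ (Finset.Icc 1 ⌊x⌋₊).card := by
    apply Finset.card_le_card
    intro z hz
    have := h z hz
    rw [Finset.mem_Icc]
    exact ⟨this.1, Nat.le_floor this.2⟩
  rw [Nat.card_Icc] at this
  calc (Z.card : ℝ) ≤ (⌊x⌋₊ : ℕ) := by exact_mod_cast (by simpa using this)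
    _ ≤ x := Nat.floor_le hx

lemma P_nonneg (n k : ℕ) : 0 ≤ P n k := by unfold P; positivity

lemma card_idx (n k : ℕ) : ((idx n k).card : ℝ) ≤ (n : ℝ) ^ ((k : ℝ)⁻¹) := by
  apply card_le_of _ _ _ (P_nonneg n k)
  intro z hz
  simp only [idx, Finset.mem_filter] at hz
  exact ⟨hz.2.1.pos, hz.2.2.2⟩

lemma idx_pow (n k : ℕ) (hk : k ≠ 0) : ∀ a ∈ idx n k, 0 < a ∧ a ^ k ≤ n := by
  intro z hz
  simp only [idx, Finset.mem_filter] at hz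
  refine ⟨hz.2.1.pos, ?_⟩
  have h := pow_le_pow_left₀ (by positivity) hz.2.2.2 k
  unfold P at h
  rw [Real.rpow_inv_natCast_pow (by positivity) hk] at h
  exact_mod_cast h

lemma log_idx (n a : ℕ) (h : a < n + 1) : Real.log a ≤ Real.log n := by
  rcases Nat.eq_zero_or_pos a with h0 | h0
  · subst h0; simpa using Real.log_natCast_nonneg n
  · exact Real.log_le_log (by exact_mod_cast h0) (by exact_mod_cast Nat.lt_succ_iff.mp h)

lemma mean_bound (ε : ℝ) (hε : 0 < ε) : ∃ C : ℝ, 0 < C ∧ ∀ (n k : ℕ) (Z : Finset ℕ) (ζ : ℝ),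
    1 ≤ n → k ≠ 0 → 1 / 6 ≤ ζ → (∀ z ∈ Z, z < n + 1) → (Z.card : ℝ) ≤ (n : ℝ) ^ ζ →
    ∫ α in (0:ℝ)..1, ‖f n 2 α * f n 3 α * W Z k α‖ ^ 2 ≤
      C * (n : ℝ) ^ (2 / 3 + 2 * ζ + 7 * ε) := by
  obtain ⟨C1, hC1, hdiv⟩ := div_bound ε hε
  refine ⟨(1 / ε) ^ 6 * (2 * C1 + 1), by positivity, fun n k Z ζ hn hk hζ hZ hZc => ?_⟩
  have hn0 : (0 : ℝ) < n := by exact_mod_cast hn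
  have hn1 : (1 : ℝ) ≤ n := by exact_mod_cast hn
  set D : ℕ := ⌊C1 * (n : ℝ) ^ ε⌋₊ with hDdef
  have hD : ∀ m : ℕ, m ≠ 0 → m ≤ n → m.divisors.card ≤ D := by
    intro m hm hmn
    apply Nat.le_floor
    refine (hdiv m hm).trans ?_
    gcongr
  have hDle : (D : ℝ) ≤ C1 * (n : ℝ) ^ ε := Nat.floor_le (by positivity)
  have hlog : Real.log n ≤ 1 / ε * (n : ℝ) ^ ε := by
    have := Real.log_le_rpow_div hn0.le hε
    calc _ ≤ _ := this
      _ = _ := by ring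
  have hlog0 : 0 ≤ Real.log n := Real.log_natCast_nonneg n
  have hmv := mean_value (idx n 2) (idx n 3) Z k n D hk (Real.log n) (idx_pow n 2 (by norm_num))
    (idx_pow n 3 (by norm_num)) hD
    (fun a ha => log_idx n a (by simp [idx] at ha; omega))
    (fun a ha => log_idx n a (by simp [idx] at ha; omega))
    (fun a ha => log_idx n a (hZ a ha))
  rw [f_eq, f_eq]
  refine hmv.trans ?_
  have c2 := card_idx n 2
  have c3 := card_idx n 3
  set a : ℝ := ((idx n 2).card : ℝ)
  set b : ℝ := ((idx n 3).card : ℝ)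
  set z : ℝ := (Z.card : ℝ)
  have ha : 0 ≤ a := by positivity
  have hb : 0 ≤ b := by positivity
  have hz : 0 ≤ z := by positivity
  have mono : ∀ {x y : ℝ}, x ≤ y → (n : ℝ) ^ x ≤ (n : ℝ) ^ y := fun h =>
    Real.rpow_le_rpow_of_exponent_le hn1 h
  have t1 : D * (b * z) ^ 2 ≤ C1 * (n : ℝ) ^ (2 / 3 + 2 * ζ + ε) := by
    calc _ ≤ (C1 * (n : ℝ) ^ ε) * ((n : ℝ) ^ (((3 : ℕ) : ℝ)⁻¹) * (n : ℝ) ^ ζ) ^ 2 := by gcongr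
      _ = C1 * (n : ℝ) ^ (2 / 3 + 2 * ζ + ε) := by
        rw [← Real.rpow_add hn0, ← Real.rpow_natCast, ← Real.rpow_mul hn0.le, mul_assoc,
          ← Real.rpow_add hn0]
        congr 2; push_cast; ring
  have t2 : a * (D * z ^ 2) ≤ C1 * (n : ℝ) ^ (2 / 3 + 2 * ζ + ε) := by
    calc _ ≤ (n : ℝ) ^ (((2 : ℕ) : ℝ)⁻¹) * ((C1 * (n : ℝ) ^ ε) * ((n : ℝ) ^ ζ) ^ 2) := by gcongr
      _ = C1 * ((n : ℝ) ^ (((2 : ℕ) : ℝ)⁻¹) * ((n : ℝ) ^ ε * ((n : ℝ) ^ ζ) ^ 2)) := by ring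
      _ = C1 * (n : ℝ) ^ (1 / 2 + 2 * ζ + ε) := by
        rw [← Real.rpow_natCast ((n : ℝ) ^ ζ), ← Real.rpow_mul hn0.le, ← Real.rpow_add hn0,
          ← Real.rpow_add hn0]
        congr 2; push_cast; ring
      _ ≤ _ := by
        apply mul_le_mul_of_nonneg_left _ hC1.le
        apply mono; linarith
  have t3 : a * (b * z) ≤ (n : ℝ) ^ (2 / 3 + 2 * ζ + ε) := by
    calc _ ≤ (n : ℝ) ^ (((2 : ℕ) : ℝ)⁻¹) * ((n : ℝ) ^ (((3 : ℕ) : ℝ)⁻¹) * (n : ℝ) ^ ζ) := by gcongr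
      _ = (n : ℝ) ^ (5 / 6 + ζ) := by
        rw [← Real.rpow_add hn0, ← Real.rpow_add hn0]
        congr 1; push_cast; ring
      _ ≤ _ := by apply mono; linarith
  have t4 : Real.log n ^ 6 ≤ (1 / ε) ^ 6 * (n : ℝ) ^ (6 * ε) := by
    calc _ ≤ (1 / ε * (n : ℝ) ^ ε) ^ 6 := by gcongr
      _ = _ := by
        rw [mul_pow, ← Real.rpow_natCast ((n : ℝ) ^ ε), ← Real.rpow_mul hn0.le]
        congr 2; push_cast; ring
  calc _ ≤ ((1 / ε) ^ 6 * (n : ℝ) ^ (6 * ε)) * ((2 * C1 + 1) * (n : ℝ) ^ (2 / 3 + 2 * ζ + ε)) := by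
        apply mul_le_mul t4 _ (by positivity) (by positivity)
        linarith
    _ = (1 / ε) ^ 6 * (2 * C1 + 1) * ((n : ℝ) ^ (6 * ε) * (n : ℝ) ^ (2 / 3 + 2 * ζ + ε)) := by ring
    _ = _ := by
        rw [← Real.rpow_add hn0]
        congr 2; ring

/-- The contribution of the set `𝓔_c` is `≪ n^{Θ_c - τ}` with `τ = 2^{-20}`. -/
theorem E_contribution (c : ℕ) (hc : c = 6 ∨ c = 7) :
    ∃ C : ℝ, 0 < C ∧ ∃ N : ℕ, ∀ n : ℕ, N ≤ n →
      (∫ α in E n c, ‖F n c α‖) ≤ C * (n : ℝ) ^ (Θ c - τ) := by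
  have hτ : 0 < τ := by unfold τ; positivity
  obtain ⟨C, hC, hmb⟩ := mean_bound (τ / 4) (by positivity)
  refine ⟨C, hC, 1, fun n hn => ?_⟩
  have hn0 : (0 : ℝ) < n := by exact_mod_cast hn
  have hn1 : (1 : ℝ) ≤ n := by exact_mod_cast hn
  set ζ : ℝ := θ c / 5 with hζ
  have hζ6 : 1 / 6 ≤ ζ := by
    rw [hζ]; unfold θ; split_ifs <;> norm_num
  have h5 := hmb n 5 (idx5 n c) ζ hn (by norm_num) hζ6
    (fun z hz => by simp [idx5] at hz; omega)
    (by
      have hx : (n : ℝ) ^ ζ = P n 5 ^ θ c := by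
        unfold P
        rw [← Real.rpow_mul hn0.le, hζ]
        congr 1; push_cast; ring
      rw [hx]
      apply card_le_of _ _ _ (Real.rpow_nonneg (P_nonneg n 5) _)
      intro z hz
      simp only [idx5, Finset.mem_filter] at hz
      exact ⟨hz.2.1.pos, hz.2.2.2⟩)
  have h6 := hmb n 6 (idx n 6) (1 / 6) hn (by norm_num) le_rfl
    (fun z hz => by simp [idx] at hz; omega)
    (by have := card_idx n 6; norm_num at this ⊢; exact this)
  rw [← f5_eq] at h5
  rw [← f_eq] at h6
  have cf : ∀ k, Continuous (f n k) := fun k => by rw [f_eq]; exact continuous_W _ _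
  have cf5 : Continuous (f5 n c) := by rw [f5_eq]; exact continuous_W _ _
  have c2 := cf 2
  have c3 := cf 3
  have c6 := cf 6
  have cc := cf c
  set b : ℝ := (c : ℝ)⁻¹ * (if c = 6 then 1 - 24 * τ else 139 / 140 - 24 * τ) with hb
  have hPb : P n c ^ (if c = 6 then 1 - 24 * τ else 139 / 140 - 24 * τ) = (n : ℝ) ^ b := by
    unfold P
    rw [← Real.rpow_mul hn0.le]
  have hbexp : b + (5 / 6 + ζ + 7 * (τ / 4)) ≤ Θ c - τ := by
    unfold Θ
    rw [hb, hζ]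
    rcases hc with rfl | rfl
    · norm_num; linarith
    · norm_num; linarith
  set lam : ℝ := (n : ℝ) ^ (1 / 6 - ζ) with hlam
  have hlam0 : 0 < lam := by positivity
  have hinv : lam⁻¹ = (n : ℝ) ^ (ζ - 1 / 6) := by
    rw [hlam, ← Real.rpow_neg hn0.le]; congr 1; ring
  let g5 : ℝ → ℝ := fun α => ‖f n 2 α * f n 3 α * f5 n c α‖ ^ 2
  let g6 : ℝ → ℝ := fun α => ‖f n 2 α * f n 3 α * f n 6 α‖ ^ 2
  have cg5 : Continuous g5 := by fun_prop
  have cg6 : Continuous g6 := by fun_prop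
  let h : ℝ → ℝ := fun α => (n : ℝ) ^ b / 2 * (lam * g5 α + lam⁻¹ * g6 α)
  have ch : Continuous h := by fun_prop
  have hEsub : E n c ⊆ Set.Icc 0 1 := fun α hα => hα.1
  have hEm : MeasurableSet (E n c) := by
    apply IsClosed.measurableSet
    exact isClosed_Icc.inter (isClosed_le cc.norm continuous_const)
  have hpt : ∀ α ∈ E n c, ‖F n c α‖ ≤ h α := by
    intro α hα
    have hfc : ‖f n c α‖ ≤ (n : ℝ) ^ b := by rw [← hPb]; exact hα.2
    have hF : ‖F n c α‖ = ‖f n 2 α * f n 3 α * f5 n c α‖ * ‖f n 2 α * f n 3 α * f n 6 α‖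
        * ‖f n c α‖ := by
      unfold F
      simp only [norm_mul, norm_pow]; ring
    rw [hF]
    simp only [h, g5, g6]
    set u := ‖f n 2 α * f n 3 α * f5 n c α‖
    set v' := ‖f n 2 α * f n 3 α * f n 6 α‖
    have hu : 0 ≤ u := norm_nonneg _
    have hv : 0 ≤ v' := norm_nonneg _
    have key : 2 * (u * v') ≤ lam * u ^ 2 + lam⁻¹ * v' ^ 2 := by
      have h1 : 0 ≤ lam⁻¹ * (lam * u - v') ^ 2 := by positivity
      have h2 : lam⁻¹ * (lam * u - v') ^ 2 = lam * u ^ 2 + lam⁻¹ * v' ^ 2 - 2 * (u * v') := by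
        field_simp; ring
      linarith
    calc u * v' * ‖f n c α‖ ≤ u * v' * (n : ℝ) ^ b := by gcongr
      _ = (n : ℝ) ^ b / 2 * (2 * (u * v')) := by ring
      _ ≤ _ := by gcongr
  have hnn : ∀ α, 0 ≤ h α := fun α => by simp only [h, g5, g6]; positivity
  have cF : Continuous (fun α => ‖F n c α‖) := by unfold F; fun_prop
  have hhI : IntegrableOn h (Set.Icc 0 1) := ch.continuousOn.integrableOn_Icc
  have hFI : IntegrableOn (fun α => ‖F n c α‖) (Set.Icc 0 1) := cF.continuousOn.integrableOn_Icc
  have hint : ∫ α in (0:ℝ)..1, h α = (n : ℝ) ^ b / 2 *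
      (lam * (∫ α in (0:ℝ)..1, g5 α) + lam⁻¹ * ∫ α in (0:ℝ)..1, g6 α) := by
    simp only [h]
    rw [intervalIntegral.integral_const_mul, intervalIntegral.integral_add,
      intervalIntegral.integral_const_mul, intervalIntegral.integral_const_mul]
    · exact (cg5.const_mul lam).intervalIntegrable 0 1
    · exact (cg6.const_mul lam⁻¹).intervalIntegrable 0 1
  have e5 : lam * (n : ℝ) ^ (2 / 3 + 2 * ζ + 7 * (τ / 4)) = (n : ℝ) ^ (5 / 6 + ζ + 7 * (τ / 4)) := by
    rw [hlam, ← Real.rpow_add hn0]; congr 1; ring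
  have e6 : lam⁻¹ * (n : ℝ) ^ (2 / 3 + 2 * (1 / 6) + 7 * (τ / 4)) =
      (n : ℝ) ^ (5 / 6 + ζ + 7 * (τ / 4)) := by
    rw [hinv, ← Real.rpow_add hn0]; congr 1; ring
  calc (∫ α in E n c, ‖F n c α‖) ≤ ∫ α in E n c, h α :=
        setIntegral_mono_on (hFI.mono_set hEsub) (hhI.mono_set hEsub) hEm hpt
    _ ≤ ∫ α in Set.Icc (0 : ℝ) 1, h α :=
        setIntegral_mono_set hhI (Filter.Eventually.of_forall hnn) hEsub.eventuallyLE
    _ = ∫ α in (0:ℝ)..1, h α := by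
        rw [intervalIntegral.integral_of_le zero_le_one, integral_Icc_eq_integral_Ioc]
    _ ≤ (n : ℝ) ^ b / 2 * (lam * (C * (n : ℝ) ^ (2 / 3 + 2 * ζ + 7 * (τ / 4))) +
          lam⁻¹ * (C * (n : ℝ) ^ (2 / 3 + 2 * (1 / 6) + 7 * (τ / 4)))) := by
        rw [hint]
        gcongr
    _ = C * ((n : ℝ) ^ b / 2 * (lam * (n : ℝ) ^ (2 / 3 + 2 * ζ + 7 * (τ / 4)) +
          lam⁻¹ * (n : ℝ) ^ (2 / 3 + 2 * (1 / 6) + 7 * (τ / 4)))) := by ring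
    _ = C * ((n : ℝ) ^ b * (n : ℝ) ^ (5 / 6 + ζ + 7 * (τ / 4))) := by rw [e5, e6]; ring
    _ ≤ C * (n : ℝ) ^ (Θ c - τ) := by
        rw [← Real.rpow_add hn0]
        apply mul_le_mul_of_nonneg_left _ hC.le
        exact Real.rpow_le_rpow_of_exponent_le hn1 hbexp
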